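/- Let X be a finite alphabet and Ψ = {S_j : X* → ℝ^p | j ∈ J} a family of formal power series. If R is a reachable representation of Ψ and R_min is a minimal representation of Ψ, then there exists a surjective representation morphism T : R → R_min. Consequently, any two minimal representations of Ψ are isomorphic. -/

import Mathlib

open Matrix

section PowerSeriesDefs

variable {X J : Type*} {p n : ℕ}

/-- `A_w = A_{σ_k} ⋯ A_{σ_1}` for the word `w = σ_1 ⋯ σ_k`. -/
def wordProd {n : ℕ} (A : X → Matrix (Fin n) (Fin n) ℝ) : List X → Matrix (Fin n) (Fin n) ℝ
  | [] => 1
  | σ :: w => wordProd A w * A σ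

/-- Column of the full Hankel matrix of the family `S`, indexed by `(w, j)`. -/
def hankelCol (S : J → List X → Fin p → ℝ) (w : List X) (j : J) : List X × Fin p → ℝ :=
  fun vi => S j (w ++ vi.1) vi.2

/-- Linear span of the columns of the full Hankel matrix `H_Ψ`. -/
def fullHankelSpan (S : J → List X → Fin p → ℝ) : Submodule ℝ (List X × Fin p → ℝ) :=
  Submodule.span ℝ (Set.range fun wj : List X × J => hankelCol S wj.1 wj.2)

/-- Column of the sub-Hankel matrix `H_{Ψ,M,K}` (rows restricted to `|v| ≤ M`). -/
def hankelColTrunc (S : J → List X → Fin p → ℝ) (M : ℕ) (w : List X) (j : J) :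
    {v : List X // v.length ≤ M} × Fin p → ℝ :=
  fun vi => S j (w ++ vi.1.1) vi.2

/-- `rank H_{Ψ,M,K}` : dimension of the span of the columns of the sub-Hankel matrix
whose rows are indexed by `(v,i)` with `|v| ≤ M` and whose columns are indexed by
`(w,j)` with `|w| ≤ K`. -/
noncomputable def hankelRank (S : J → List X → Fin p → ℝ) (M K : ℕ) : ℕ :=
  Module.finrank ℝ (Submodule.span ℝ
    (Set.range fun wj : {w : List X // w.length ≤ K} × J =>
      hankelColTrunc S M wj.1.1 wj.2))

/-- `R = (ℝⁿ, {A_σ}, B, C)` is an `N`-partial representation of the family `S`. -/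
def IsPartialRep (S : J → List X → Fin p → ℝ) (N : ℕ)
    (A : X → Matrix (Fin n) (Fin n) ℝ) (B : J → Fin n → ℝ)
    (C : Matrix (Fin p) (Fin n) ℝ) : Prop :=
  ∀ (j : J) (w : List X), w.length ≤ N → S j w = C.mulVec ((wordProd A w).mulVec (B j))

/-- `R = (ℝⁿ, {A_σ}, B, C)` is a (complete) representation of the family `S`. -/
def IsRep (S : J → List X → Fin p → ℝ)
    (A : X → Matrix (Fin n) (Fin n) ℝ) (B : J → Fin n → ℝ)
    (C : Matrix (Fin p) (Fin n) ℝ) : Prop :=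
  ∀ (j : J) (w : List X), S j w = C.mulVec ((wordProd A w).mulVec (B j))

/-- Reachability: the span of the vectors `A_w B_j` is the whole state space. -/
def IsReachable (A : X → Matrix (Fin n) (Fin n) ℝ) (B : J → Fin n → ℝ) : Prop :=
  Submodule.span ℝ
    {x : Fin n → ℝ | ∃ (w : List X) (j : J), x = (wordProd A w).mulVec (B j)} = ⊤

/-- Observability: the intersection of the kernels of the maps `C A_w` is trivial. -/
def IsObservable (A : X → Matrix (Fin n) (Fin n) ℝ)
    (C : Matrix (Fin p) (Fin n) ℝ) : Prop :=
  ∀ x : Fin n → ℝ, (∀ w : List X, C.mulVec ((wordProd A w).mulVec x) = 0) → x = 0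

end PowerSeriesDefs

/-- `T` is a representation morphism from `(ℝⁿ, A, B, C)` to `(ℝ^{n'}, A', B', C')`. -/
def IsRepMorphism {X J : Type*} {p n n' : ℕ}
    (A : X → Matrix (Fin n) (Fin n) ℝ) (B : J → Fin n → ℝ)
    (C : Matrix (Fin p) (Fin n) ℝ)
    (A' : X → Matrix (Fin n') (Fin n') ℝ) (B' : J → Fin n' → ℝ)
    (C' : Matrix (Fin p) (Fin n') ℝ)
    (T : Matrix (Fin n') (Fin n) ℝ) : Prop :=
  (∀ σ : X, T * A σ = A' σ * T) ∧ (∀ j : J, T.mulVec (B j) = B' j) ∧ C = C' * T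

/-- A linear map intertwining the letters intertwines the action of all words. -/
lemma map_wordProd_mulVec {X E : Type*} [AddCommGroup E] [Module ℝ E] {n : ℕ}
    {A : X → Matrix (Fin n) (Fin n) ℝ} {a : X → E →ₗ[ℝ] E} {f : (Fin n → ℝ) →ₗ[ℝ] E}
    (hf : ∀ σ x, f (A σ *ᵥ x) = a σ (f x)) (w : List X) (x : Fin n → ℝ) :
    f (wordProd A w *ᵥ x) = w.foldl (fun y σ => a σ y) (f x) := by
  induction w generalizing x with
  | nil => simp [wordProd]
  | cons σ w ih => rw [wordProd, ← mulVec_mulVec, ih, hf, List.foldl_cons]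

lemma wordProd_append {X : Type*} {n : ℕ} (A : X → Matrix (Fin n) (Fin n) ℝ) (v w : List X) :
    wordProd A (v ++ w) = wordProd A w * wordProd A v := by
  induction v with
  | nil => simp [wordProd]
  | cons σ v ih => rw [List.cons_append, wordProd, wordProd, ih, Matrix.mul_assoc]

/-- A linear system on an arbitrary space generating `S` restricts, on a finite-dimensional
invariant subspace containing the initial vectors, to a matrix representation of `S`. -/
lemma exists_isRep_of_invariant {X J E : Type*} [AddCommGroup E] [Module ℝ E] {p : ℕ}
    {S : J → List X → Fin p → ℝ} (a : X → E →ₗ[ℝ] E) (b : J → E) (c : E →ₗ[ℝ] (Fin p → ℝ))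
    (V : Submodule ℝ E) [FiniteDimensional ℝ V]
    (ha : ∀ σ, ∀ x ∈ V, a σ x ∈ V) (hb : ∀ j, b j ∈ V)
    (hS : ∀ j w, S j w = c (w.foldl (fun y σ => a σ y) (b j))) :
    ∃ (A : X → Matrix (Fin (Module.finrank ℝ V)) (Fin (Module.finrank ℝ V)) ℝ)
      (B : J → Fin (Module.finrank ℝ V) → ℝ) (C : Matrix (Fin p) (Fin (Module.finrank ℝ V)) ℝ),
      IsRep S A B C := by
  let e : V ≃ₗ[ℝ] (Fin (Module.finrank ℝ V) → ℝ) := (Module.finBasis ℝ V).equivFun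
  let f : (Fin (Module.finrank ℝ V) → ℝ) →ₗ[ℝ] E := V.subtype ∘ₗ e.symm.toLinearMap
  let A : X → Matrix (Fin (Module.finrank ℝ V)) (Fin (Module.finrank ℝ V)) ℝ := fun σ =>
    LinearMap.toMatrix' (e.toLinearMap ∘ₗ (a σ).restrict (ha σ) ∘ₗ e.symm.toLinearMap)
  have hf : ∀ σ x, f (A σ *ᵥ x) = a σ (f x) := by
    intro σ x
    simp [A, f, LinearMap.toMatrix'_mulVec]
  refine ⟨A, fun j => e ⟨b j, hb j⟩, LinearMap.toMatrix' (c ∘ₗ f), fun j w => ?_⟩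
  rw [LinearMap.toMatrix'_mulVec, LinearMap.comp_apply, map_wordProd_mulVec hf, hS]
  simp [f]

/-- The observability map `x ↦ (w ↦ C A_w x)`. -/
def obsMap {X : Type*} {p n : ℕ} (A : X → Matrix (Fin n) (Fin n) ℝ)
    (C : Matrix (Fin p) (Fin n) ℝ) : (Fin n → ℝ) →ₗ[ℝ] (List X → Fin p → ℝ) :=
  LinearMap.pi fun w => C.mulVecLin ∘ₗ (wordProd A w).mulVecLin

lemma obsMap_apply {X : Type*} {p n : ℕ} (A : X → Matrix (Fin n) (Fin n) ℝ)
    (C : Matrix (Fin p) (Fin n) ℝ) (x : Fin n → ℝ) (w : List X) :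
    obsMap A C x w = C *ᵥ (wordProd A w *ᵥ x) := rfl

/-- The shift of a formal power series by a letter. -/
def letterShift {X : Type*} (p : ℕ) (σ : X) :
    (List X → Fin p → ℝ) →ₗ[ℝ] (List X → Fin p → ℝ) :=
  LinearMap.funLeft ℝ (Fin p → ℝ) (List.cons σ)

lemma obsMap_mulVec {X : Type*} {p n : ℕ} (A : X → Matrix (Fin n) (Fin n) ℝ)
    (C : Matrix (Fin p) (Fin n) ℝ) (σ : X) (x : Fin n → ℝ) :
    obsMap A C (A σ *ᵥ x) = letterShift p σ (obsMap A C x) := by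
  funext w
  simp [letterShift, LinearMap.funLeft_apply, obsMap_apply, wordProd]

lemma foldl_letterShift_apply {X : Type*} {p : ℕ} (w v : List X) (s : List X → Fin p → ℝ) :
    w.foldl (fun y σ => letterShift p σ y) s v = s (w ++ v) := by
  induction w generalizing s with
  | nil => rfl
  | cons σ w ih => rw [List.foldl_cons, ih]; rfl

section Representation

variable {X J : Type*} {p n : ℕ} {S : J → List X → Fin p → ℝ}
  {A : X → Matrix (Fin n) (Fin n) ℝ} {B : J → Fin n → ℝ} {C : Matrix (Fin p) (Fin n) ℝ}

lemma IsRep.obsMap_wordProd (h : IsRep S A B C) (w : List X) (j : J) :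
    obsMap A C (wordProd A w *ᵥ B j) = fun v => S j (w ++ v) := by
  funext v
  rw [obsMap_apply, h, wordProd_append, ← mulVec_mulVec (B j)]

lemma IsRep.obsMap_initial (h : IsRep S A B C) (j : J) : obsMap A C (B j) = S j := by
  simpa [wordProd] using h.obsMap_wordProd [] j

lemma IsRep.isReachable_of_minimal (h : IsRep S A B C)
    (hmin : ∀ (n' : ℕ) (A' : X → Matrix (Fin n') (Fin n') ℝ) (B' : J → Fin n' → ℝ)
      (C' : Matrix (Fin p) (Fin n') ℝ), IsRep S A' B' C' → n ≤ n') :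
    IsReachable A B := by
  unfold IsReachable
  set V := Submodule.span ℝ
    {x : Fin n → ℝ | ∃ (w : List X) (j : J), x = (wordProd A w).mulVec (B j)} with hV
  have ha : ∀ σ, ∀ x ∈ V, (A σ).mulVecLin x ∈ V := by
    intro σ
    suffices V ≤ V.comap (A σ).mulVecLin from this
    conv_lhs => rw [hV]
    rw [Submodule.span_le]
    rintro _ ⟨w, j, rfl⟩
    refine Submodule.subset_span ⟨w ++ [σ], j, ?_⟩
    simp [wordProd_append, wordProd]
  have hb : ∀ j, B j ∈ V := fun j => Submodule.subset_span ⟨[], j, by simp [wordProd]⟩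
  obtain ⟨A', B', C', h'⟩ := exists_isRep_of_invariant (S := S) (fun σ => (A σ).mulVecLin) B
    C.mulVecLin V ha hb fun j w => by
      rw [h j w, mulVecLin_apply]
      exact congrArg _ (map_wordProd_mulVec (f := LinearMap.id) (fun _ _ => rfl) w (B j))
  have hle := hmin _ A' B' C' h'
  apply Submodule.eq_top_of_finrank_eq
  have := Submodule.finrank_le V
  rw [Module.finrank_fin_fun] at this ⊢
  exact le_antisymm this hle

lemma IsRep.obsMap_injective_of_minimal (h : IsRep S A B C)
    (hmin : ∀ (n' : ℕ) (A' : X → Matrix (Fin n') (Fin n') ℝ) (B' : J → Fin n' → ℝ)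
      (C' : Matrix (Fin p) (Fin n') ℝ), IsRep S A' B' C' → n ≤ n') :
    Function.Injective (obsMap A C) := by
  obtain ⟨A', B', C', h'⟩ := exists_isRep_of_invariant (S := S) (letterShift p) S
    (LinearMap.proj []) (LinearMap.range (obsMap A C))
    (by
      rintro σ _ ⟨x, rfl⟩
      exact ⟨A σ *ᵥ x, obsMap_mulVec A C σ x⟩)
    (fun j => ⟨B j, h.obsMap_initial j⟩)
    (fun j w => by simp [foldl_letterShift_apply])
  have hle := hmin _ A' B' C' h'
  have hrank := LinearMap.finrank_range_add_finrank_ker (obsMap A C)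
  rw [Module.finrank_fin_fun] at hrank
  rw [← LinearMap.ker_eq_bot, ← Submodule.finrank_eq_zero (R := ℝ)]
  omega

/-- A reachable representation maps onto every minimal one. -/
lemma IsRep.exists_surjective_morphism (h : IsRep S A B C) (hr : IsReachable A B) {m : ℕ}
    {A' : X → Matrix (Fin m) (Fin m) ℝ} {B' : J → Fin m → ℝ} {C' : Matrix (Fin p) (Fin m) ℝ}
    (h' : IsRep S A' B' C')
    (hmin : ∀ (n' : ℕ) (A'' : X → Matrix (Fin n') (Fin n') ℝ) (B'' : J → Fin n' → ℝ)
      (C'' : Matrix (Fin p) (Fin n') ℝ), IsRep S A'' B'' C'' → m ≤ n') :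
    ∃ T : Matrix (Fin m) (Fin n) ℝ,
      IsRepMorphism A B C A' B' C' T ∧ Function.Surjective T.mulVec := by
  have hinj := h'.obsMap_injective_of_minimal hmin
  have hr' := h'.isReachable_of_minimal hmin
  obtain ⟨L, hL⟩ := LinearMap.exists_leftInverse_of_injective _ (LinearMap.ker_eq_bot.2 hinj)
  have hrange : ∀ x, obsMap A C x ∈ LinearMap.range (obsMap A' C') := by
    suffices (⊤ : Submodule ℝ (Fin n → ℝ)) ≤
        (LinearMap.range (obsMap A' C')).comap (obsMap A C) from fun x => this trivial
    rw [← hr, Submodule.span_le]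
    rintro _ ⟨w, j, rfl⟩
    exact ⟨wordProd A' w *ᵥ B' j, by rw [h.obsMap_wordProd, h'.obsMap_wordProd]⟩
  let T := LinearMap.toMatrix' (L ∘ₗ obsMap A C)
  have hT : ∀ x, obsMap A' C' (T *ᵥ x) = obsMap A C x := by
    intro x
    obtain ⟨y, hy⟩ := hrange x
    have hLy : L (obsMap A' C' y) = y := LinearMap.congr_fun hL y
    rw [LinearMap.toMatrix'_mulVec, LinearMap.comp_apply, ← hy, hLy]
  refine ⟨T, ⟨fun σ => ?_, fun j => ?_, ?_⟩, ?_⟩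
  · refine ext_of_mulVec_single fun i => hinj ?_
    rw [← mulVec_mulVec, ← mulVec_mulVec, hT, obsMap_mulVec, obsMap_mulVec, hT]
  · exact hinj (by rw [hT, h.obsMap_initial, h'.obsMap_initial])
  · refine ext_of_mulVec_single fun i => ?_
    rw [← mulVec_mulVec]
    simpa only [obsMap_apply, wordProd, one_mulVec] using (congrFun (hT (Pi.single i 1)) []).symm
  · suffices (⊤ : Submodule ℝ (Fin m → ℝ)) ≤ LinearMap.range T.mulVecLin from
      fun y => this trivial
    rw [← hr', Submodule.span_le]
    rintro _ ⟨w, j, rfl⟩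
    exact ⟨wordProd A w *ᵥ B j,
      hinj ((hT _).trans (by rw [h.obsMap_wordProd, h'.obsMap_wordProd]))⟩

end Representation

/-- if `R` is a reachable representation of `Ψ` and `R_min` is a minimal
representation of `Ψ`, then there is a surjective representation morphism
`T : R → R_min`; consequently, any two minimal representations of `Ψ` are isomorphic. -/
theorem stmt11 {X J : Type*} [Fintype X] {p : ℕ} (S : J → List X → Fin p → ℝ) :
    (∀ (n nm : ℕ) (A : X → Matrix (Fin n) (Fin n) ℝ) (B : J → Fin n → ℝ)
       (C : Matrix (Fin p) (Fin n) ℝ)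
       (Am : X → Matrix (Fin nm) (Fin nm) ℝ) (Bm : J → Fin nm → ℝ)
       (Cm : Matrix (Fin p) (Fin nm) ℝ),
       IsRep S A B C → IsReachable A B →
       IsRep S Am Bm Cm →
       (∀ (n' : ℕ) (A' : X → Matrix (Fin n') (Fin n') ℝ) (B' : J → Fin n' → ℝ)
          (C' : Matrix (Fin p) (Fin n') ℝ), IsRep S A' B' C' → nm ≤ n') →
       ∃ T : Matrix (Fin nm) (Fin n) ℝ,
         IsRepMorphism A B C Am Bm Cm T ∧ Function.Surjective T.mulVec) ∧
    (∀ (n n' : ℕ) (A : X → Matrix (Fin n) (Fin n) ℝ) (B : J → Fin n → ℝ)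
       (C : Matrix (Fin p) (Fin n) ℝ)
       (A' : X → Matrix (Fin n') (Fin n') ℝ) (B' : J → Fin n' → ℝ)
       (C' : Matrix (Fin p) (Fin n') ℝ),
       IsRep S A B C → IsRep S A' B' C' →
       (∀ (n'' : ℕ) (A'' : X → Matrix (Fin n'') (Fin n'') ℝ) (B'' : J → Fin n'' → ℝ)
          (C'' : Matrix (Fin p) (Fin n'') ℝ), IsRep S A'' B'' C'' → n ≤ n'') →
       (∀ (n'' : ℕ) (A'' : X → Matrix (Fin n'') (Fin n'') ℝ) (B'' : J → Fin n'' → ℝ)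
          (C'' : Matrix (Fin p) (Fin n'') ℝ), IsRep S A'' B'' C'' → n' ≤ n'') →
       ∃ T : Matrix (Fin n') (Fin n) ℝ,
         IsRepMorphism A B C A' B' C' T ∧ Function.Bijective T.mulVec) := by
  refine ⟨fun n nm A B C Am Bm Cm h hr hm hmin => h.exists_surjective_morphism hr hm hmin, ?_⟩
  intro n n' A B C A' B' C' h h' hmin hmin'
  obtain ⟨T, hT, hsurj⟩ :=
    h.exists_surjective_morphism (h.isReachable_of_minimal hmin) h' hmin'
  have hn : n = n' := le_antisymm (hmin _ _ _ _ h') (hmin' _ _ _ _ h)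
  subst hn
  exact ⟨T, hT, LinearMap.injective_iff_surjective (f := T.mulVecLin).2 hsurj, hsurj⟩
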